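/- Let 𝒳 and 𝒴 be countable sets, μ_0 a pmf on 𝒳, Γ ≥ 0, and 𝒮(Γ) = {μ : D_KL(μ‖μ_0) ≤ Γ}. Let Q be a Markov kernel from 𝒳 to 𝒴 such that I(μ, Q) < ∞ for every μ ∈ 𝒮(Γ), and set Ī = sup_{μ∈𝒮(Γ)} I(μ, Q). Then there exist a probability space carrying a random variable Z valued in some measurable space 𝒵 and a measurable function g : 𝒳 × 𝒵 → 𝒴 such that, for every μ ∈ 𝒮(Γ), if X ∼ μ is independent of Z and Y := g(X, Z), then (X, Y) has joint pmf μ(x)Q(y|x), and H(Y | Z) ≤ Ī + Γ + log₂( Ī + Γ + 1 ) + 4. -/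

import Mathlib

open MeasureTheory ProbabilityTheory
open scoped ENNReal
attribute [local instance] Classical.propDecidable

/-- Base-2 entropy of a pmf on a countable type: `H(p) = -∑ p(a) log₂ p(a)`. -/
noncomputable def ent2 {𝒴 : Type*} (p : PMF 𝒴) : ℝ :=
  ∑' y, -((p y).toReal * Real.logb 2 (p y).toReal)

/-- Joint pmf `μ(x) Q(y|x)` on `𝒳 × 𝒴` induced by a source pmf `μ` and a Markov kernel `Q`. -/
noncomputable def jointPMF {𝒳 𝒴 : Type*} (μ : PMF 𝒳) (Q : 𝒳 → PMF 𝒴) : PMF (𝒳 × 𝒴) :=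
  μ.bind fun x => (Q x).map (Prod.mk x)

/-- Summand of the mutual information `I(μ, Q)` (base 2). -/
noncomputable def miSummand {𝒳 𝒴 : Type*} (μ : PMF 𝒳) (Q : 𝒳 → PMF 𝒴) (p : 𝒳 × 𝒴) : ℝ :=
  ((μ p.1) * (Q p.1 p.2)).toReal *
    Real.logb 2 ((Q p.1 p.2).toReal / ((μ.bind Q) p.2).toReal)

/-- Mutual information (base 2) `I(μ, Q) = ∑_{x,y} μ(x)Q(y|x) log₂ (Q(y|x)/q(y))`. -/
noncomputable def mutInfo {𝒳 𝒴 : Type*} (μ : PMF 𝒳) (Q : 𝒳 → PMF 𝒴) : ℝ :=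
  ∑' p, miSummand μ Q p

/-- Kullback–Leibler divergence (base 2) between pmfs on a countable type, valued in
`[0,∞]`: it is `∑ p(a) log₂ (p(a)/r(a))` when `p ≪ r` and the sum converges, `∞` otherwise. -/

noncomputable def klDivE {α : Type*} (p r : PMF α) : ℝ≥0∞ :=
  if (∀ a, r a = 0 → p a = 0) ∧
      Summable (fun a => (p a).toReal * Real.logb 2 ((p a).toReal / (r a).toReal))
  then ENNReal.ofReal (∑' a, (p a).toReal * Real.logb 2 ((p a).toReal / (r a).toReal))
  else ⊤

/-- `κ` is a regular conditional distribution of the (discrete-valued) random variable `Y`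
given `Z`, under the probability measure `P`. -/
def IsCondDistrib {Ω 𝒴 𝒵 : Type*} [MeasurableSpace Ω] [MeasurableSpace 𝒵]
    (P : Measure Ω) (Y : Ω → 𝒴) (Z : Ω → 𝒵) (κ : 𝒵 → PMF 𝒴) : Prop :=
  (∀ y, Measurable fun z => κ z y) ∧
    ∀ (y : 𝒴) (A : Set 𝒵), MeasurableSet A →
      P {ω | Y ω = y ∧ Z ω ∈ A} = ∫⁻ z in A, κ z y ∂(P.map Z)

open Set Filter Topology

/-- The standard exponential law on the real line. -/
noncomputable def stdExp : Measure ℝ :=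
  (volume.restrict (Ioi 0)).withDensity fun t => ENNReal.ofReal (Real.exp (-t))

lemma lintegral_stdExp {F : ℝ → ℝ≥0∞} (hF : Measurable F) :
    ∫⁻ t, F t ∂stdExp = ∫⁻ t in Ioi 0, ENNReal.ofReal (Real.exp (-t)) * F t := by
  rw [stdExp, lintegral_withDensity_eq_lintegral_mul _ (by fun_prop) hF]
  rfl

lemma stdExp_Ioi {a : ℝ} (ha : 0 ≤ a) : stdExp (Ioi a) = ENNReal.ofReal (Real.exp (-a)) := by
  rw [stdExp, withDensity_apply _ measurableSet_Ioi, Measure.restrict_restrict measurableSet_Ioi,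
    inter_eq_left.2 (Ioi_subset_Ioi ha), ← integral_exp_neg_Ioi a,
    ofReal_integral_eq_lintegral_ofReal]
  · exact integrableOn_exp_neg_Ioi a
  · exact ae_of_all _ fun t => (Real.exp_pos _).le

lemma ae_stdExp_pos : ∀ᵐ t ∂stdExp, 0 < t := by
  rw [stdExp]
  exact (withDensity_absolutelyContinuous _ _).ae_le (ae_restrict_mem measurableSet_Ioi)

instance : IsProbabilityMeasure stdExp := ⟨by
  have h : stdExp (Ioi 0)ᶜ = 0 := ae_stdExp_pos
  rw [← measure_add_measure_compl (measurableSet_Ioi (a := (0 : ℝ))), h, stdExp_Ioi le_rfl]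
  simp⟩

section Race

variable {ι : Type}

/-- The law of a family of independent standard exponential clocks. -/
noncomputable def clocks (ι : Type) : Measure (ι → ℝ) := Measure.infinitePi fun _ => stdExp

instance : IsProbabilityMeasure (clocks ι) := by unfold clocks; infer_instance

lemma measurePreserving_update_clocks (i : ι) :
    MeasurePreserving (fun p : ℝ × (ι → ℝ) => Function.update p.2 i p.1)
      (stdExp.prod (clocks ι)) (clocks ι) := by
  have hm : Measurable fun p : ℝ × (ι → ℝ) => Function.update p.2 i p.1 := by
    refine measurable_pi_iff.2 fun j => ?_
    by_cases h : j = i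
    · subst h; simpa using measurable_fst
    · simp only [Function.update_of_ne h]; fun_prop
  refine ⟨hm, Measure.eq_infinitePi _ fun s t ht => ?_⟩
  rw [Measure.map_apply hm (.pi s.countable_toSet fun j _ => ht j)]
  by_cases hi : i ∈ s
  · have : (fun p : ℝ × (ι → ℝ) => Function.update p.2 i p.1) ⁻¹' Set.pi s t =
        t i ×ˢ Set.pi (s.erase i : Finset ι) t := by
      ext p
      simp only [mem_preimage, Set.mem_pi, mem_prod, Finset.mem_coe, Finset.mem_erase]
      constructor
      · intro h
        exact ⟨by simpa using h i hi, fun j hj => by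
          simpa [Function.update_of_ne hj.1] using h j hj.2⟩
      · rintro ⟨h1, h2⟩ j hj
        by_cases hji : j = i
        · subst hji; simpa using h1
        · simpa [Function.update_of_ne hji] using h2 j ⟨hji, hj⟩
    rw [this, Measure.prod_prod, clocks, Measure.infinitePi_pi _ fun j _ => ht j]
    exact Finset.mul_prod_erase s (fun j => stdExp (t j)) hi
  · have : (fun p : ℝ × (ι → ℝ) => Function.update p.2 i p.1) ⁻¹' Set.pi s t =
        univ ×ˢ Set.pi s t := by
      ext p
      simp only [mem_preimage, Set.mem_pi, mem_prod, Finset.mem_coe, mem_univ, true_and]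
      refine forall₂_congr fun j hj => ?_
      rw [Function.update_of_ne (by rintro rfl; exact hi hj)]
    rw [this, Measure.prod_prod, clocks, Measure.infinitePi_pi _ fun j _ => ht j]
    simp

/-- The event that the clock `y`, run at speed `q y`, rings first. -/
def raceWin (q : PMF ι) (y : ι) : Set (ι → ℝ) :=
  {z | ∀ y', y' ≠ y → z y * (q y').toReal < z y' * (q y).toReal}

lemma measurableSet_raceWin [Countable ι] (q : PMF ι) (y : ι) : MeasurableSet (raceWin q y) := by
  have : raceWin q y =
      ⋂ y' : ι, ⋂ _ : y' ≠ y, {z | z y * (q y').toReal < z y' * (q y).toReal} := by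
    ext; simp [raceWin]
  rw [this]
  exact .iInter fun y' => .iInter fun _ => measurableSet_lt (by fun_prop) (by fun_prop)

lemma hasSum_toReal_pmf (q : PMF ι) : HasSum (fun y => (q y).toReal) 1 := by
  have := (ENNReal.summable_toReal q.tsum_coe_ne_top).hasSum
  rwa [← ENNReal.tsum_toReal_eq fun y => q.apply_ne_top y, q.tsum_coe, ENNReal.toReal_one] at this

lemma clocks_later [Countable ι] (q : PMF ι) {y : ι} (hy : 0 < (q y).toReal) {t : ℝ} (ht : 0 ≤ t) :
    clocks ι {f | ∀ y', y' ≠ y → t * (q y').toReal < f y' * (q y).toReal} =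
      ENNReal.ofReal (Real.exp (t - t / (q y).toReal)) := by
  set a : ι → ℝ := fun y' => t * (q y').toReal / (q y).toReal with ha
  have hset : {f : ι → ℝ | ∀ y', y' ≠ y → t * (q y').toReal < f y' * (q y).toReal} =
      Set.pi univ fun y' => if y' = y then univ else Ioi (a y') := by
    ext f
    simp only [mem_ofPred_eq, Set.mem_pi, mem_univ, true_imp_iff]
    refine forall_congr' fun y' => ?_
    by_cases h : y' = y
    · simp [h]
    · simp [h, ha, div_lt_iff₀ hy]
  have hsum : HasSum (fun y' => if y' = y then 0 else a y') (t / (q y).toReal - t) := by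
    have h1 : HasSum a (t / (q y).toReal) := by
      simpa using ((hasSum_toReal_pmf q).mul_left t).div_const (q y).toReal
    have h2 := h1.update y 0
    convert! h2 using 1
    · ext y'; by_cases h : y' = y <;> simp [h, Function.update]
    · simp only [ha]; field_simp; ring
  rw [hset, clocks, Measure.infinitePi_pi_univ]
  · have hp : HasProd (fun y' => stdExp (if y' = y then univ else Ioi (a y')))
        (ENNReal.ofReal (Real.exp (-(t / (q y).toReal - t)))) := by
      have hc : Continuous fun u : ℝ => ENNReal.ofReal (Real.exp (-u)) :=
        ENNReal.continuous_ofReal.comp (by fun_prop)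
      refine ((hc.tendsto _).comp hsum).congr fun s => ?_
      simp only [Function.comp_apply]
      rw [← Finset.sum_neg_distrib, Real.exp_sum,
        ENNReal.ofReal_prod_of_nonneg fun _ _ => (Real.exp_pos _).le]
      refine Finset.prod_congr rfl fun y' _ => ?_
      by_cases h : y' = y
      · simp [h]
      · simp only [h, if_false]
        rw [stdExp_Ioi (by positivity)]
    rw [hp.tprod_eq]
    ring_nf
  · intro y'
    split_ifs
    exacts [.univ, measurableSet_Ioi]

lemma setLIntegral_raceWin [Countable ι] (q : PMF ι) {y : ι} (hy : 0 < (q y).toReal) {F : ℝ → ℝ≥0∞}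
    (hF : Measurable F) :
    ∫⁻ z in raceWin q y, F (z y) ∂clocks ι =
      ∫⁻ t in Ioi 0, F t * ENNReal.ofReal (Real.exp (-(t / (q y).toReal))) := by
  rw [← lintegral_indicator (measurableSet_raceWin q y)]
  have hG : Measurable ((raceWin q y).indicator fun z : ι → ℝ => F (z y)) :=
    (hF.comp (measurable_pi_apply y)).indicator (measurableSet_raceWin q y)
  have hU := measurePreserving_update_clocks y
  have hGU : Measurable fun p : ℝ × (ι → ℝ) =>
      (raceWin q y).indicator (fun z : ι → ℝ => F (z y)) (Function.update p.2 y p.1) :=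
    hG.comp hU.measurable
  rw [← hU.lintegral_comp hG, lintegral_prod _ hGU.aemeasurable,
    lintegral_stdExp hGU.lintegral_prod_right']
  refine setLIntegral_congr_fun measurableSet_Ioi fun t ht => ?_
  have hms : MeasurableSet
      {f : ι → ℝ | ∀ y', y' ≠ y → t * (q y').toReal < f y' * (q y).toReal} := by
    simp only [ofPred_forall]
    exact .iInter fun y' => .iInter fun _ => measurableSet_lt (by fun_prop) (by fun_prop)
  have : ∀ f : ι → ℝ, (raceWin q y).indicator (fun z : ι → ℝ => F (z y)) (Function.update f y t) =
      {f : ι → ℝ | ∀ y', y' ≠ y → t * (q y').toReal < f y' * (q y).toReal}.indicator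
        (fun _ => F t) f := by
    intro f
    simp only [indicator, raceWin, mem_ofPred_eq, Function.update_self]
    congr 1
    refine propext (forall₂_congr fun y' hy' => ?_)
    rw [Function.update_of_ne hy']
  simp only [this]
  rw [lintegral_indicator_const hms, clocks_later q hy (le_of_lt ht), mul_left_comm,
    ← ENNReal.ofReal_mul (Real.exp_pos _).le, ← Real.exp_add]
  ring_nf

/-- Moments of the winning time up to first order. -/
lemma lintegral_affine_mul_exp {c : ℝ} (hc : 0 < c) {a b : ℝ} (h : ∀ t > 0, 0 ≤ a + b * t) :
    ∫⁻ t in Ioi (0 : ℝ), ENNReal.ofReal (a + b * t) * ENNReal.ofReal (Real.exp (-(t / c))) =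
      ENNReal.ofReal (a * c + b * c ^ 2) := by
  set G : ℝ → ℝ := fun t => -(a * c + b * c ^ 2 + b * c * t) * Real.exp (-(t / c)) with hG
  have hd : ∀ t ∈ Ici (0 : ℝ), HasDerivAt G ((a + b * t) * Real.exp (-(t / c))) t := by
    intro t _
    have h1 : HasDerivAt (fun t : ℝ => Real.exp (-(t / c))) (Real.exp (-(t / c)) * -(1 / c)) t :=
      ((hasDerivAt_id t).div_const c).neg.exp
    have h2 : HasDerivAt (fun t : ℝ => -(a * c + b * c ^ 2 + b * c * t)) (-(b * c * 1)) t :=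
      (((hasDerivAt_id t).const_mul (b * c)).const_add _).neg
    convert! h2.mul h1 using 1
    field_simp
    ring
  have hpos : ∀ t ∈ Ioi (0 : ℝ), 0 ≤ (a + b * t) * Real.exp (-(t / c)) := fun t ht =>
    mul_nonneg (h t ht) (Real.exp_pos _).le
  have hlim : Tendsto G atTop (𝓝 0) := by
    have hdiv : Tendsto (fun t : ℝ => t / c) atTop atTop := tendsto_id.atTop_div_const hc
    have h0 := (Real.tendsto_pow_mul_exp_neg_atTop_nhds_zero 0).comp hdiv
    have h1 := (Real.tendsto_pow_mul_exp_neg_atTop_nhds_zero 1).comp hdiv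
    have := (h0.const_mul (-(a * c + b * c ^ 2))).add (h1.const_mul (-(b * c ^ 2)))
    simp only [mul_zero, add_zero] at this
    refine this.congr fun t => ?_
    simp only [Function.comp_apply, hG]
    field_simp
    ring
  have hint := integrableOn_Ioi_deriv_of_nonneg' hd hpos hlim
  have hval := integral_Ioi_of_hasDerivAt_of_nonneg' hd hpos hlim
  have : a * c + b * c ^ 2 = ∫ t in Ioi (0 : ℝ), (a + b * t) * Real.exp (-(t / c)) := by
    rw [hval]; simp [hG]
  rw [this, ofReal_integral_eq_lintegral_ofReal hint
    ((ae_restrict_mem measurableSet_Ioi).mono hpos)]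
  refine setLIntegral_congr_fun measurableSet_Ioi fun t ht => ?_
  rw [← ENNReal.ofReal_mul (h t ht)]

lemma clocks_raceWin [Countable ι] (q : PMF ι) {y : ι} (hy : 0 < (q y).toReal) :
    clocks ι (raceWin q y) = q y := by
  have h1 := setLIntegral_raceWin q hy (F := fun _ => 1) measurable_const
  have h2 := lintegral_affine_mul_exp hy (a := 1) (b := 0) (by simp)
  simp only [lintegral_const, one_mul, Measure.restrict_apply_univ] at h1
  simp only [zero_mul, add_zero, ENNReal.ofReal_one, one_mul] at h2
  rw [h1, h2, ENNReal.ofReal_toReal (q.apply_ne_top y)]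

/-- Density `s (1 + t)^{-(1+s)}` on the half-line, rescaled, has mass at most `c` against
the exponential clock. -/
lemma lintegral_pareto_le {c s : ℝ} (hc : 0 < c) (hs : 0 < s) :
    ∫⁻ t, ENNReal.ofReal (s * (1 + t / c) ^ (-(1 + s))) ∂stdExp ≤ ENNReal.ofReal c := by
  rw [lintegral_stdExp (by fun_prop)]
  have hb : ∀ t ∈ Ici (0 : ℝ), 0 < 1 + t / c := fun t ht => by
    have : 0 ≤ t := ht
    positivity
  have hd : ∀ t ∈ Ici (0 : ℝ), HasDerivAt (fun t : ℝ => -c * (1 + t / c) ^ (-s))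
      (s * (1 + t / c) ^ (-(1 + s))) t := by
    intro t ht
    have h1 : HasDerivAt (fun t : ℝ => 1 + t / c) (1 / c) t :=
      ((hasDerivAt_id t).div_const c).const_add 1
    convert! (h1.rpow_const (p := -s) (Or.inl (hb t ht).ne')).const_mul (-c) using 1
    rw [show -s - 1 = -(1 + s) by ring]
    field_simp
  have hpos : ∀ t ∈ Ioi (0 : ℝ), 0 ≤ s * (1 + t / c) ^ (-(1 + s)) := fun t ht =>
    mul_nonneg hs.le (Real.rpow_nonneg (hb t (mem_Ici.2 (le_of_lt ht))).le _)
  have hlim : Tendsto (fun t : ℝ => -c * (1 + t / c) ^ (-s)) atTop (𝓝 0) := by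
    have h1 : Tendsto (fun t : ℝ => 1 + t / c) atTop atTop :=
      tendsto_atTop_add_const_left _ _ (tendsto_id.atTop_div_const hc)
    simpa using ((tendsto_rpow_neg_atTop hs).comp h1).const_mul (-c)
  have hint := integrableOn_Ioi_deriv_of_nonneg' hd hpos hlim
  have hval := integral_Ioi_of_hasDerivAt_of_nonneg' hd hpos hlim
  have : c = ∫ t in Ioi (0 : ℝ), s * (1 + t / c) ^ (-(1 + s)) := by rw [hval]; simp
  conv_rhs => rw [this]
  rw [ofReal_integral_eq_lintegral_ofReal hint
    ((ae_restrict_mem measurableSet_Ioi).mono hpos)]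
  refine setLIntegral_mono' measurableSet_Ioi fun t ht => ?_
  refine mul_le_of_le_one_left' ?_
  rw [← ENNReal.ofReal_one]
  exact ENNReal.ofReal_le_ofReal (Real.exp_le_one_iff.2 (by simpa using le_of_lt ht))

lemma raceWin_unique {q : PMF ι} {z : ι → ℝ} {y y' : ι} (h : z ∈ raceWin q y)
    (h' : z ∈ raceWin q y') : y = y' := by
  by_contra hne
  exact lt_asymm (h y' (Ne.symm hne)) (h' y hne)

/-- The clock that rings first when clock `y` runs at speed `q y`. -/
noncomputable def raceOutcome [Nonempty ι] (q : PMF ι) (z : ι → ℝ) : ι :=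
  if h : ∃ y, 0 < (q y).toReal ∧ z ∈ raceWin q y then h.choose else Classical.arbitrary ι

lemma raceOutcome_eq [Nonempty ι] {q : PMF ι} {z : ι → ℝ} {y : ι} (hy : 0 < (q y).toReal)
    (h : z ∈ raceWin q y) : raceOutcome q z = y := by
  have hex : ∃ y, 0 < (q y).toReal ∧ z ∈ raceWin q y := ⟨y, hy, h⟩
  rw [raceOutcome, dif_pos hex]
  exact raceWin_unique hex.choose_spec.2 h

lemma measurableSet_pos_raceWin [Countable ι] (q : PMF ι) (y : ι) :
    MeasurableSet {z | 0 < (q y).toReal ∧ z ∈ raceWin q y} :=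
  (MeasurableSet.const _).inter (measurableSet_raceWin q y)

lemma measurable_raceOutcome [Countable ι] [Nonempty ι] [MeasurableSpace ι] (q : PMF ι) :
    Measurable (raceOutcome q) := by
  refine measurable_to_countable' fun y => ?_
  have hU : MeasurableSet {z : ι → ℝ | ∃ y, 0 < (q y).toReal ∧ z ∈ raceWin q y} := by
    simp only [ofPred_exists]
    exact .iUnion fun y => measurableSet_pos_raceWin q y
  have : raceOutcome q ⁻¹' {y} = {z | 0 < (q y).toReal ∧ z ∈ raceWin q y} ∪
      ({z | ∃ y, 0 < (q y).toReal ∧ z ∈ raceWin q y}ᶜ ∩ {_z | Classical.arbitrary ι = y}) := by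
    ext z
    simp only [mem_preimage, mem_singleton_iff, mem_union, mem_inter_iff, mem_compl_iff,
      mem_ofPred_eq]
    by_cases h : ∃ y, 0 < (q y).toReal ∧ z ∈ raceWin q y
    · obtain ⟨y', hy', hz⟩ := h
      rw [raceOutcome_eq hy' hz]
      constructor
      · rintro rfl; exact Or.inl ⟨hy', hz⟩
      · rintro (h | h)
        · exact raceWin_unique hz h.2
        · exact absurd ⟨y', hy', hz⟩ h.1
    · rw [raceOutcome, dif_neg h]
      constructor
      · exact fun h' => Or.inr ⟨h, h'⟩
      · rintro (h' | h')
        · exact absurd ⟨y, h'⟩ h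
        · exact h'.2
  rw [this]
  exact (measurableSet_pos_raceWin q y).union (hU.compl.inter (.const _))

lemma clocks_pos_raceWin [Countable ι] (q : PMF ι) (y : ι) :
    clocks ι {z | 0 < (q y).toReal ∧ z ∈ raceWin q y} = q y := by
  by_cases hy : 0 < (q y).toReal
  · simpa [hy] using clocks_raceWin q hy
  · have : q y = 0 := by
      simpa [ENNReal.toReal_pos_iff, pos_iff_ne_zero, (q.apply_ne_top y).lt_top] using hy
    simp [this]

lemma ae_raceOutcome_eq_iff [Countable ι] [Nonempty ι] (q : PMF ι) :
    ∀ᵐ z ∂clocks ι, ∀ y, raceOutcome q z = y ↔ 0 < (q y).toReal ∧ z ∈ raceWin q y := by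
  have hU : clocks ι (⋃ y, {z | 0 < (q y).toReal ∧ z ∈ raceWin q y}) = 1 := by
    rw [measure_iUnion _ (measurableSet_pos_raceWin q)]
    · simp only [clocks_pos_raceWin, q.tsum_coe]
    · intro y y' hne
      exact Set.disjoint_left.2 fun z hz hz' => hne (raceWin_unique hz.2 hz'.2)
  have hU' : ∀ᵐ z ∂clocks ι, z ∈ ⋃ y, {z | 0 < (q y).toReal ∧ z ∈ raceWin q y} :=
    (prob_compl_eq_zero_iff (.iUnion (measurableSet_pos_raceWin q))).2 hU
  filter_upwards [hU'] with z hz y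
  obtain ⟨y', hy', hz'⟩ := mem_iUnion.1 hz
  constructor
  · rintro rfl
    rw [raceOutcome_eq hy' hz']
    exact ⟨hy', hz'⟩
  · exact fun h => raceOutcome_eq h.1 h.2

lemma clocks_raceOutcome [Countable ι] [Nonempty ι] (q : PMF ι) (y : ι) :
    clocks ι {z | raceOutcome q z = y} = q y := by
  rw [← clocks_pos_raceWin q y]
  refine measure_congr ?_
  filter_upwards [ae_raceOutcome_eq_iff q] with z hz
  exact propext (hz y)

lemma measurePreserving_eval_clocks (y : ι) :
    MeasurePreserving (fun z : ι → ℝ => z y) (clocks ι) stdExp :=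
  measurePreserving_eval_infinitePi (fun _ : ι => stdExp) y

lemma ae_clocks_pos [Countable ι] : ∀ᵐ z ∂clocks ι, ∀ y, 0 < z y := by
  rw [ae_all_iff]
  intro y
  exact (measurePreserving_eval_clocks y).quasiMeasurePreserving.ae ae_stdExp_pos

lemma setLIntegral_raceOutcome_le [Countable ι] [Nonempty ι] (q : PMF ι) {y : ι}
    (hy : 0 < (q y).toReal) {F : ℝ → ℝ≥0∞} (hF : Measurable F) {a b : ℝ}
    (hab : ∀ t > 0, 0 ≤ a + b * t) (hle : ∀ t > 0, F t ≤ ENNReal.ofReal (a + b * t)) :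
    ∫⁻ z in {z | raceOutcome q z = y}, F (z y) ∂clocks ι ≤
      ENNReal.ofReal (a * (q y).toReal + b * (q y).toReal ^ 2) := by
  have hae : ({z | raceOutcome q z = y} : Set (ι → ℝ)) =ᵐ[clocks ι] raceWin q y := by
    filter_upwards [ae_raceOutcome_eq_iff q] with z hz
    exact propext ((hz y).trans (and_iff_right hy))
  rw [setLIntegral_congr hae, setLIntegral_raceWin q hy hF, ← lintegral_affine_mul_exp hy hab]
  exact setLIntegral_mono' measurableSet_Ioi fun t ht => mul_le_mul_left (hle t ht) _

end Race

section Gibbs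

lemma logb_two_le {u : ℝ} (hu : 0 < u) : Real.logb 2 u ≤ (Real.log 2)⁻¹ * (u - 1) := by
  rw [Real.logb, div_eq_inv_mul]
  exact mul_le_mul_of_nonneg_left (Real.log_le_sub_one_of_pos hu)
    (inv_nonneg.2 (Real.log_nonneg one_le_two))

/-- Gibbs' inequality in linearised form, against an unnormalised weight `r` with code
lengths `ℓ = -log₂ r`. -/
lemma ent2_add_le {ι : Type*} (p : PMF ι) (r l : ι → ℝ≥0∞)
    (h : ∀ y, l y = ⊤ ∨ ∃ ρ > 0, r y = ENNReal.ofReal ρ ∧ l y = ENNReal.ofReal (-Real.logb 2 ρ)) :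
    ENNReal.ofReal (ent2 p) + ENNReal.ofReal (Real.log 2)⁻¹ ≤
      ∑' y, p y * l y + ENNReal.ofReal (Real.log 2)⁻¹ * ∑' y, r y := by
  have hc : 0 ≤ (Real.log 2)⁻¹ := inv_nonneg.2 (Real.log_nonneg one_le_two)
  have hpp : ∀ y, (p y).toReal ≤ 1 := fun y => by
    simpa using ENNReal.toReal_mono ENNReal.one_ne_top (p.coe_le_one y)
  have hnn : ∀ y, 0 ≤ -((p y).toReal * Real.logb 2 (p y).toReal) := fun y =>
    neg_nonneg.2 (mul_nonpos_of_nonneg_of_nonpos ENNReal.toReal_nonneg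
      (Real.logb_nonpos one_lt_two ENNReal.toReal_nonneg (hpp y)))
  have h1 : ENNReal.ofReal (ent2 p) ≤
      ∑' y, ENNReal.ofReal (-((p y).toReal * Real.logb 2 (p y).toReal)) := by
    by_cases hs : Summable fun y => -((p y).toReal * Real.logb 2 (p y).toReal)
    · exact (ENNReal.ofReal_tsum_of_nonneg hnn hs).le
    · rw [ent2, tsum_eq_zero_of_not_summable hs]; simp
  have h2 : ENNReal.ofReal (Real.log 2)⁻¹ = ∑' y, ENNReal.ofReal (Real.log 2)⁻¹ * p y := by
    rw [ENNReal.tsum_mul_left, p.tsum_coe, mul_one]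
  calc ENNReal.ofReal (ent2 p) + ENNReal.ofReal (Real.log 2)⁻¹
      ≤ ∑' y, ENNReal.ofReal (-((p y).toReal * Real.logb 2 (p y).toReal)) +
          ∑' y, ENNReal.ofReal (Real.log 2)⁻¹ * p y := add_le_add h1 h2.le
    _ = ∑' y, (ENNReal.ofReal (-((p y).toReal * Real.logb 2 (p y).toReal)) +
          ENNReal.ofReal (Real.log 2)⁻¹ * p y) := ENNReal.tsum_add.symm
    _ ≤ ∑' y, (p y * l y + ENNReal.ofReal (Real.log 2)⁻¹ * r y) := by
        refine ENNReal.tsum_le_tsum fun y => ?_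
        by_cases hp : p y = 0
        · simp [hp]
        rcases h y with h | ⟨ρ, hρ, hr, hl⟩
        · simp [h, ENNReal.mul_top hp]
        have hp0 : 0 < (p y).toReal := ENNReal.toReal_pos hp (p.apply_ne_top y)
        have e1 : ENNReal.ofReal (Real.log 2)⁻¹ * p y =
            ENNReal.ofReal ((Real.log 2)⁻¹ * (p y).toReal) := by
          rw [ENNReal.ofReal_mul hc, ENNReal.ofReal_toReal (p.apply_ne_top y)]
        have e2 : p y * ENNReal.ofReal (-Real.logb 2 ρ) =
            ENNReal.ofReal ((p y).toReal * -Real.logb 2 ρ) := by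
          rw [ENNReal.ofReal_mul hp0.le, ENNReal.ofReal_toReal (p.apply_ne_top y)]
        rw [hr, hl, e1, e2, ← ENNReal.ofReal_mul hc,
          ← ENNReal.ofReal_add (hnn y) (mul_nonneg hc hp0.le)]
        refine le_trans (ENNReal.ofReal_le_ofReal ?_) ENNReal.ofReal_add_le
        have h3 := logb_two_le (div_pos hρ hp0)
        rw [Real.logb_div hρ.ne' hp0.ne'] at h3
        have h4 := mul_le_mul_of_nonneg_left h3 hp0.le
        have h5 : (p y).toReal * ((Real.log 2)⁻¹ * (ρ / (p y).toReal - 1)) =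
            (Real.log 2)⁻¹ * ρ - (Real.log 2)⁻¹ * (p y).toReal := by
          field_simp
        linarith
    _ = _ := by rw [ENNReal.tsum_add, ENNReal.tsum_mul_left]

lemma ent2_nonneg {ι : Type*} (p : PMF ι) : 0 ≤ ent2 p :=
  tsum_nonneg fun y => neg_nonneg.2 (mul_nonpos_of_nonneg_of_nonpos ENNReal.toReal_nonneg
    (Real.logb_nonpos one_lt_two ENNReal.toReal_nonneg
      (by simpa using ENNReal.toReal_mono ENNReal.one_ne_top (p.coe_le_one y))))

end Gibbs

section Divergence

variable {α β : Type}

lemma tsum_mul_pmf (μ : PMF α) (Q : α → PMF β) : ∑' p : α × β, μ p.1 * Q p.1 p.2 = 1 := by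
  rw [ENNReal.tsum_prod (f := fun x y => μ x * Q x y)]
  simp [ENNReal.tsum_mul_left, PMF.tsum_coe]

lemma hasSum_toReal_of_tsum_eq {F : α → ℝ≥0∞} (hF : ∑' a, F a ≠ ⊤) :
    HasSum (fun a => (F a).toReal) (∑' a, F a).toReal := by
  rw [ENNReal.tsum_toReal_eq (ENNReal.ne_top_of_tsum_ne_top hF)]
  exact (ENNReal.summable_toReal hF).hasSum

lemma hasSum_mul_pmf (μ : PMF α) (Q : α → PMF β) :
    HasSum (fun p : α × β => (μ p.1).toReal * (Q p.1 p.2).toReal) 1 := by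
  have := hasSum_toReal_of_tsum_eq (F := fun p : α × β => μ p.1 * Q p.1 p.2)
    (by simp [tsum_mul_pmf])
  simpa [tsum_mul_pmf, ENNReal.toReal_mul] using this

lemma hasSum_mul_kernel {f : α → ℝ} (hf : Summable f) (Q : α → PMF β) :
    HasSum (fun p : α × β => f p.1 * (Q p.1 p.2).toReal) (∑' x, f x) := by
  have hs : Summable fun p : α × β => f p.1 * (Q p.1 p.2).toReal := by
    have habs : Summable fun p : α × β => |f p.1| * (Q p.1 p.2).toReal := by
      refine (summable_prod_of_nonneg
        fun p => mul_nonneg (abs_nonneg _) ENNReal.toReal_nonneg).2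
          ⟨fun x => (hasSum_toReal_pmf (Q x)).summable.mul_left |f x|, hf.abs.congr fun x => ?_⟩
      exact (mul_one |f x|).symm.trans ((hasSum_toReal_pmf (Q x)).mul_left |f x|).tsum_eq.symm
    refine Summable.of_norm (habs.congr fun p => ?_)
    rw [norm_mul, Real.norm_eq_abs, Real.norm_eq_abs, ENNReal.abs_toReal]
  have := hs.hasSum.prod_fiberwise fun x => (hasSum_toReal_pmf (Q x)).mul_left (f x)
  simp only [mul_one] at this
  rw [this.tsum_eq]
  exact hs.hasSum

lemma exists_hasSum_ratio_le_one (μ μ₀ : PMF α) (Q : α → PMF β) :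
    ∃ T ≤ 1, HasSum (fun p : α × β => (μ₀ p.1).toReal * (Q p.1 p.2).toReal *
      (((μ.bind Q) p.2).toReal / ((μ₀.bind Q) p.2).toReal)) T := by
  set F : α × β → ℝ≥0∞ := fun p => μ₀ p.1 * Q p.1 p.2 * ((μ.bind Q) p.2 / (μ₀.bind Q) p.2)
  have hF : ∑' p, F p ≤ 1 := by
    rw [ENNReal.tsum_prod (f := fun x y => μ₀ x * Q x y * ((μ.bind Q) y / (μ₀.bind Q) y)),
      ENNReal.tsum_comm]
    simp only [ENNReal.tsum_mul_right, ← PMF.bind_apply]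
    exact (ENNReal.tsum_le_tsum fun y => ENNReal.mul_div_le).trans_eq (PMF.tsum_coe _)
  refine ⟨(∑' p, F p).toReal, by simpa using ENNReal.toReal_mono ENNReal.one_ne_top hF, ?_⟩
  have := hasSum_toReal_of_tsum_eq (ne_top_of_le_ne_top ENNReal.one_ne_top hF)
  simpa [F, ENNReal.toReal_mul, ENNReal.toReal_div] using this

lemma bind_toReal_pos {μ : PMF α} {Q : α → PMF β} {x : α} {y : β} (hx : 0 < (μ x).toReal)
    (hy : 0 < (Q x y).toReal) : 0 < ((μ.bind Q) y).toReal := by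
  refine ENNReal.toReal_pos (fun h => ?_) (PMF.apply_ne_top _ _)
  rw [PMF.bind_apply, ENNReal.tsum_eq_zero] at h
  rcases mul_eq_zero.1 (h x) with h | h <;> simp [h] at hx hy

lemma miSummand_ge (μ : PMF α) (Q : α → PMF β) (p : α × β) :
    (Real.log 2)⁻¹ * ((μ p.1).toReal * (Q p.1 p.2).toReal -
      (μ p.1).toReal * ((μ.bind Q) p.2).toReal) ≤ miSummand μ Q p := by
  obtain ⟨x, y⟩ := p
  have hc : 0 ≤ (Real.log 2)⁻¹ := inv_nonneg.2 (Real.log_nonneg one_le_two)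
  simp only [miSummand, ENNReal.toReal_mul]
  rcases (ENNReal.toReal_nonneg (a := μ x)).eq_or_lt with hx | hx
  · simp [← hx]
  rcases (ENNReal.toReal_nonneg (a := Q x y)).eq_or_lt with hy | hy
  · simp only [← hy, mul_zero, zero_mul, zero_sub]
    exact mul_nonpos_of_nonneg_of_nonpos hc (neg_nonpos.2 (by positivity))
  have hq := bind_toReal_pos hx hy
  have h1 := logb_two_le (div_pos hq hy)
  rw [Real.logb_div hq.ne' hy.ne'] at h1
  rw [Real.logb_div hy.ne' hq.ne']
  have h2 := mul_le_mul_of_nonneg_left h1 (mul_pos hx hy).le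
  have h3 : (μ x).toReal * (Q x y).toReal *
      ((Real.log 2)⁻¹ * (((μ.bind Q) y).toReal / (Q x y).toReal - 1)) =
      (Real.log 2)⁻¹ * ((μ x).toReal * ((μ.bind Q) y).toReal - (μ x).toReal * (Q x y).toReal) := by
    field_simp
  linarith

lemma mutInfo_nonneg {μ : PMF α} {Q : α → PMF β} (h : Summable (miSummand μ Q)) :
    0 ≤ mutInfo μ Q := by
  have h1 := ((hasSum_mul_pmf μ Q).sub (hasSum_mul_pmf μ fun _ => μ.bind Q)).mul_left
    (Real.log 2)⁻¹
  simpa [mutInfo] using hasSum_le (miSummand_ge μ Q) h1 h.hasSum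

lemma klDivE_le_ofReal {p r : PMF α} {Γ : ℝ} (hΓ : 0 ≤ Γ)
    (h : klDivE p r ≤ ENNReal.ofReal Γ) :
    (∀ a, r a = 0 → p a = 0) ∧
      Summable (fun a => (p a).toReal * Real.logb 2 ((p a).toReal / (r a).toReal)) ∧
      ∑' a, (p a).toReal * Real.logb 2 ((p a).toReal / (r a).toReal) ≤ Γ := by
  unfold klDivE at h
  split_ifs at h with hc
  · exact ⟨hc.1, hc.2, (ENNReal.ofReal_le_ofReal_iff hΓ).1 h⟩
  · simp at h

/-- Termwise bound for the expected code length at `(x, y)` with Pareto index `s`. -/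
noncomputable def codeBound (μ₀ μ : PMF α) (Q : α → PMF β) (s : ℝ) (p : α × β) : ℝ :=
  -Real.logb 2 s * ((μ p.1).toReal * (Q p.1 p.2).toReal) + (1 + s) *
    (miSummand μ Q p +
      (μ p.1).toReal * Real.logb 2 ((μ p.1).toReal / (μ₀ p.1).toReal) * (Q p.1 p.2).toReal +
      (Real.log 2)⁻¹ * ((μ₀ p.1).toReal * (Q p.1 p.2).toReal *
        (((μ.bind Q) p.2).toReal / ((μ₀.bind Q) p.2).toReal) -
          (μ p.1).toReal * (Q p.1 p.2).toReal +
        (μ p.1).toReal * ((μ₀.bind Q) p.2).toReal))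

lemma exists_hasSum_codeBound_le {μ₀ μ : PMF α} {Q : α → PMF β} {s Γ : ℝ} (hs : 0 < s)
    (hΓ : 0 ≤ Γ) (hkl : klDivE μ μ₀ ≤ ENNReal.ofReal Γ) (hI : Summable (miSummand μ Q)) :
    ∃ T ≤ -Real.logb 2 s + (1 + s) * (mutInfo μ Q + Γ + (Real.log 2)⁻¹),
      HasSum (codeBound μ₀ μ Q s) T := by
  have hc : 0 ≤ (Real.log 2)⁻¹ := inv_nonneg.2 (Real.log_nonneg one_le_two)
  obtain ⟨-, hks, hkle⟩ := klDivE_le_ofReal hΓ hkl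
  obtain ⟨T, hT, hTs⟩ := exists_hasSum_ratio_le_one μ μ₀ Q
  refine ⟨_, ?_, ((hasSum_mul_pmf μ Q).mul_left (-Real.logb 2 s)).add
    (((hI.hasSum.add (hasSum_mul_kernel hks Q)).add
      (((hTs.sub (hasSum_mul_pmf μ Q)).add
        (hasSum_mul_pmf μ fun _ => μ₀.bind Q)).mul_left (Real.log 2)⁻¹)).mul_left (1 + s))⟩
  rw [mul_one]
  refine add_le_add_right (mul_le_mul_of_nonneg_left (add_le_add (add_le_add le_rfl hkle) ?_)
    (by positivity)) _
  nlinarith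

/-- Pareto weight of a clock reading `t` relative to the proposal mass `c`. -/
noncomputable def codeWeight (s c t : ℝ) : ℝ := s * (1 + t / c) ^ (-(1 + s))

lemma codeWeight_pos {s c t : ℝ} (hs : 0 < s) (hc : 0 < c) (ht : 0 < t) :
    0 < codeWeight s c t := by
  unfold codeWeight; positivity

lemma neg_logb_codeWeight {s c t : ℝ} (hs : 0 < s) (hc : 0 < c) (ht : 0 < t) :
    -Real.logb 2 (codeWeight s c t) = -Real.logb 2 s + (1 + s) * Real.logb 2 (1 + t / c) := by
  have : 0 < 1 + t / c := by positivity
  rw [codeWeight, Real.logb_mul hs.ne' (by positivity), Real.logb_rpow_eq_mul_logb_of_pos this]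
  ring

lemma neg_logb_codeWeight_nonneg {s c t : ℝ} (hs : 0 < s) (hs1 : s ≤ 1) (hc : 0 < c)
    (ht : 0 < t) : 0 ≤ -Real.logb 2 (codeWeight s c t) := by
  rw [neg_logb_codeWeight hs hc ht]
  have h1 := Real.logb_nonpos one_lt_two hs.le hs1
  have h2 : 0 ≤ Real.logb 2 (1 + t / c) := by
    refine Real.logb_nonneg one_lt_two ?_
    have : 0 < t / c := by positivity
    linarith
  nlinarith

lemma neg_logb_codeWeight_le {s c t q : ℝ} (hs : 0 < s) (hc : 0 < c) (ht : 0 < t) (hq : 0 < q) :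
    -Real.logb 2 (codeWeight s c t) ≤
      (-Real.logb 2 s + (1 + s) * (Real.logb 2 (q / c) + (Real.log 2)⁻¹ * (c / q - 1))) +
        (1 + s) * (Real.log 2)⁻¹ / q * t := by
  have h1 : 1 + t / c = (q / c) * (c / q + t / q) := by field_simp
  have h2 := logb_two_le (u := c / q + t / q) (by positivity)
  rw [neg_logb_codeWeight hs hc ht, h1, Real.logb_mul (by positivity) (by positivity)]
  have h3 := mul_le_mul_of_nonneg_left h2 (by positivity : 0 ≤ 1 + s)
  have h4 : (1 + s) * (Real.log 2)⁻¹ / q * t = (1 + s) * ((Real.log 2)⁻¹ * (t / q)) := by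
    field_simp
  rw [h4]
  linarith

lemma measurable_codeWeight (s c : ℝ) : Measurable (codeWeight s c) := by
  unfold codeWeight; fun_prop

lemma codeBound_spec [Countable β] [Nonempty β] {μ₀ μ : PMF α} {Q : α → PMF β} {s : ℝ}
    (hs : 0 < s) (hs1 : s ≤ 1) (hac : ∀ a, μ₀ a = 0 → μ a = 0) (x : α) (y : β) :
    0 ≤ codeBound μ₀ μ Q s (x, y) ∧
      μ x * ∫⁻ z in {z | raceOutcome (Q x) z = y}, (if (μ₀.bind Q) y = 0 then ⊤ else
        ENNReal.ofReal (-Real.logb 2 (codeWeight s ((μ₀.bind Q) y).toReal (z y)))) ∂clocks β ≤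
      ENNReal.ofReal (codeBound μ₀ μ Q s (x, y)) := by
  have hl : 0 < Real.log 2 := Real.log_pos one_lt_two
  rcases (ENNReal.toReal_nonneg (a := μ x)).eq_or_lt with hx | hx
  · have hx0 : μ x = 0 := by simpa [ENNReal.toReal_eq_zero_iff, μ.apply_ne_top] using hx.symm
    refine ⟨?_, by simp [hx0]⟩
    simp only [codeBound, miSummand, hx0, ENNReal.toReal_zero, zero_mul,
      mul_zero, zero_add, sub_zero, add_zero]
    positivity
  rcases (ENNReal.toReal_nonneg (a := Q x y)).eq_or_lt with hy | hy
  · have hy0 : Q x y = 0 := by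
      simpa [ENNReal.toReal_eq_zero_iff, (Q x).apply_ne_top] using hy.symm
    refine ⟨?_, ?_⟩
    · simp only [codeBound, miSummand, hy0, ENNReal.toReal_zero, zero_mul,
        mul_zero, zero_add, sub_zero, add_zero]
      positivity
    · rw [setLIntegral_measure_zero _ _ ((clocks_raceOutcome (Q x) y).trans hy0)]
      simp
  have hx0 : 0 < (μ₀ x).toReal := by
    refine ENNReal.toReal_pos (fun h => ?_) (μ₀.apply_ne_top x)
    simp [hac x h] at hx
  have hq := bind_toReal_pos hx hy
  have hq0 := bind_toReal_pos hx0 hy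
  have hq0' : (μ₀.bind Q) y ≠ 0 := fun h => by simp [h] at hq0
  have hle : ∀ t : ℝ, 0 < t → -Real.logb 2 (codeWeight s ((μ₀.bind Q) y).toReal t) ≤ _ := fun t ht =>
    neg_logb_codeWeight_le hs hq0 ht hy
  have hnn : ∀ t : ℝ, 0 < t → (0 : ℝ) ≤ _ := fun t ht =>
    (neg_logb_codeWeight_nonneg hs hs1 hq0 ht).trans (hle t ht)
  have hint := setLIntegral_raceOutcome_le (Q x) hy
    (F := fun t => ENNReal.ofReal (-Real.logb 2 (codeWeight s ((μ₀.bind Q) y).toReal t)))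
    (((measurable_codeWeight _ _).log.div_const _).neg.ennreal_ofReal) hnn
    fun t ht => ENNReal.ofReal_le_ofReal (hle t ht)
  set A := -Real.logb 2 s + (1 + s) * (Real.logb 2 ((Q x y).toReal / ((μ₀.bind Q) y).toReal) +
    (Real.log 2)⁻¹ * (((μ₀.bind Q) y).toReal / (Q x y).toReal - 1)) with hA
  set B := (1 + s) * (Real.log 2)⁻¹ / (Q x y).toReal with hB
  have h0 : 0 ≤ (μ x).toReal * (A * (Q x y).toReal + B * (Q x y).toReal ^ 2) := by
    have := mul_nonneg (hnn _ hy) hy.le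
    refine mul_nonneg hx.le ?_
    nlinarith
  have hAB : (μ x).toReal * (A * (Q x y).toReal + B * (Q x y).toReal ^ 2) ≤
      codeBound μ₀ μ Q s (x, y) := by
    have h1 := logb_two_le (div_pos (mul_pos hq hx0) (mul_pos hq0 hx))
    rw [Real.logb_div (by positivity) (by positivity), Real.logb_mul (by positivity) (by positivity),
      Real.logb_mul (by positivity) (by positivity)] at h1
    have h2 := mul_le_mul_of_nonneg_left h1
      (by positivity : 0 ≤ (1 + s) * ((μ x).toReal * (Q x y).toReal))
    simp only [codeBound, miSummand, ENNReal.toReal_mul, hA, hB]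
    rw [Real.logb_div hy.ne' hq.ne', Real.logb_div hy.ne' hq0.ne', Real.logb_div hx.ne' hx0.ne']
    rw [← sub_nonneg] at h2 ⊢
    refine h2.trans_eq ?_
    field_simp
    ring
  refine ⟨h0.trans hAB, ?_⟩
  simp only [hq0', if_false]
  refine (mul_le_mul_right hint (μ x)).trans ?_
  rw [← ENNReal.ofReal_toReal (μ.apply_ne_top x), ← ENNReal.ofReal_mul ENNReal.toReal_nonneg]
  exact ENNReal.ofReal_le_ofReal hAB

end Divergence

section Representation

lemma jointPMF_apply {𝒳 𝒴 : Type} (μ : PMF 𝒳) (Q : 𝒳 → PMF 𝒴) (x : 𝒳) (y : 𝒴) :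
    jointPMF μ Q (x, y) = μ x * Q x y := by
  rw [jointPMF, PMF.bind_apply, tsum_eq_single x]
  · rw [PMF.map_apply, tsum_eq_single y]
    · simp
    · intro y' hy'; simp [hy'.symm]
  · intro x' hx'
    rw [PMF.map_apply]
    simp [hx'.symm]

/-- The conditional law of the race outcome given all clock readings. -/
noncomputable def outcomeLaw {𝒳 𝒴 : Type} [Nonempty 𝒴] (μ : PMF 𝒳) (Q : 𝒳 → PMF 𝒴)
    (z : 𝒴 → ℝ) : PMF 𝒴 :=
  μ.map fun x => raceOutcome (Q x) z

lemma outcomeLaw_apply {𝒳 𝒴 : Type} [Nonempty 𝒴] (μ : PMF 𝒳) (Q : 𝒳 → PMF 𝒴)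
    (z : 𝒴 → ℝ) (y : 𝒴) :
    outcomeLaw μ Q z y = ∑' x, {z | raceOutcome (Q x) z = y}.indicator (fun _ => μ x) z := by
  rw [outcomeLaw, PMF.map_apply]
  refine tsum_congr fun x => ?_
  simp only [indicator, mem_ofPred_eq, eq_comm]

lemma measurable_uncurry_raceOutcome {𝒳 𝒴 : Type} [Countable 𝒳] [Countable 𝒴]
    [Nonempty 𝒴] [MeasurableSpace 𝒳] [DiscreteMeasurableSpace 𝒳] [MeasurableSpace 𝒴]
    (Q : 𝒳 → PMF 𝒴) :
    Measurable fun ω : 𝒳 × (𝒴 → ℝ) => raceOutcome (Q ω.1) ω.2 :=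
  measurable_from_prod_countable_right fun x => measurable_raceOutcome (Q x)

lemma lintegral_codeWeight_le {𝒴 : Type} [Countable 𝒴] (q : PMF 𝒴) {s : ℝ} (hs : 0 < s) :
    ∫⁻ z, ∑' y, (if q y = 0 then 0 else ENNReal.ofReal (codeWeight s (q y).toReal (z y)))
      ∂clocks 𝒴 ≤ 1 := by
  have hm : ∀ y, Measurable fun t : ℝ => ENNReal.ofReal (codeWeight s (q y).toReal t) := fun y =>
    (measurable_codeWeight _ _).ennreal_ofReal
  rw [lintegral_tsum fun y => ?_]
  · rw [← q.tsum_coe]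
    refine ENNReal.tsum_le_tsum fun y => ?_
    by_cases hy : q y = 0
    · simp [hy]
    simp only [hy, if_false]
    rw [(measurePreserving_eval_clocks y).lintegral_comp (hm y)]
    exact (lintegral_pareto_le (ENNReal.toReal_pos hy (q.apply_ne_top y)) hs).trans_eq
      (ENNReal.ofReal_toReal (q.apply_ne_top y))
  · split_ifs
    exacts [aemeasurable_const, ((hm y).comp (measurable_pi_apply y)).aemeasurable]

variable {𝒳 𝒴 : Type} [Countable 𝒳] [Countable 𝒴] [Nonempty 𝒴]
  [MeasurableSpace 𝒴] [DiscreteMeasurableSpace 𝒴]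

lemma measurableSet_raceOutcome_eq (q : PMF 𝒴) (y : 𝒴) :
    MeasurableSet {z | raceOutcome q z = y} :=
  measurable_raceOutcome q (measurableSet_singleton y)

lemma measurable_outcomeLaw (μ : PMF 𝒳) (Q : 𝒳 → PMF 𝒴) (y : 𝒴) :
    Measurable fun z => outcomeLaw μ Q z y := by
  simp only [outcomeLaw_apply]
  exact .tsum fun x => measurable_const.indicator (measurableSet_raceOutcome_eq (Q x) y)

lemma lintegral_outcomeLaw_mul (μ : PMF 𝒳) (Q : 𝒳 → PMF 𝒴) {l : 𝒴 → (𝒴 → ℝ) → ℝ≥0∞}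
    (hl : ∀ y, Measurable (l y)) :
    ∫⁻ z, ∑' y, outcomeLaw μ Q z y * l y z ∂clocks 𝒴 =
      ∑' p : 𝒳 × 𝒴, μ p.1 * ∫⁻ z in {z | raceOutcome (Q p.1) z = p.2}, l p.2 z ∂clocks 𝒴 := by
  have hm : ∀ y, AEMeasurable (fun z => outcomeLaw μ Q z y * l y z) (clocks 𝒴) := fun y =>
    ((measurable_outcomeLaw μ Q y).mul (hl y)).aemeasurable
  have hm' : ∀ y x, AEMeasurable (fun z =>
      {z | raceOutcome (Q x) z = y}.indicator (fun _ => μ x) z * l y z) (clocks 𝒴) := fun y x =>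
    ((measurable_const.indicator (measurableSet_raceOutcome_eq (Q x) y)).mul (hl y)).aemeasurable
  rw [lintegral_tsum hm, ENNReal.tsum_prod (f := fun x y =>
      μ x * ∫⁻ z in {z | raceOutcome (Q x) z = y}, l y z ∂clocks 𝒴), ENNReal.tsum_comm]
  refine tsum_congr fun y => ?_
  simp only [outcomeLaw_apply, ← ENNReal.tsum_mul_right]
  rw [lintegral_tsum (hm' y)]
  refine tsum_congr fun x => ?_
  rw [← lintegral_const_mul _ (hl y), ← lintegral_indicator (measurableSet_raceOutcome_eq (Q x) y)]
  refine lintegral_congr fun z => ?_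
  by_cases hz : z ∈ {z | raceOutcome (Q x) z = y}
  · simp only [indicator_of_mem hz]
  · simp only [indicator_of_notMem hz, zero_mul]

lemma lintegral_ent2_outcomeLaw_le {μ₀ μ : PMF 𝒳} {Q : 𝒳 → PMF 𝒴} {s Γ : ℝ} (hs : 0 < s)
    (hs1 : s ≤ 1) (hΓ : 0 ≤ Γ) (hkl : klDivE μ μ₀ ≤ ENNReal.ofReal Γ)
    (hI : Summable (miSummand μ Q)) :
    ∫⁻ z, ENNReal.ofReal (ent2 (outcomeLaw μ Q z)) ∂clocks 𝒴 ≤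
      ENNReal.ofReal (-Real.logb 2 s + (1 + s) * (mutInfo μ Q + Γ + (Real.log 2)⁻¹)) := by
  set l : 𝒴 → (𝒴 → ℝ) → ℝ≥0∞ := fun y z => if (μ₀.bind Q) y = 0 then ⊤ else
    ENNReal.ofReal (-Real.logb 2 (codeWeight s ((μ₀.bind Q) y).toReal (z y))) with hldef
  set r : 𝒴 → (𝒴 → ℝ) → ℝ≥0∞ := fun y z => if (μ₀.bind Q) y = 0 then 0 else
    ENNReal.ofReal (codeWeight s ((μ₀.bind Q) y).toReal (z y)) with hrdef
  have hl : ∀ y, Measurable (l y) := fun y => by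
    simp only [hldef]
    split_ifs
    · exact measurable_const
    · exact (((measurable_codeWeight _ _).comp
        (measurable_pi_apply y)).log.div_const _).neg.ennreal_ofReal
  obtain ⟨T, hT, hTs⟩ := exists_hasSum_codeBound_le hs hΓ hkl hI
  have hac := (klDivE_le_ofReal hΓ hkl).1
  have hcode : ∫⁻ z, ∑' y, outcomeLaw μ Q z y * l y z ∂clocks 𝒴 ≤ ENNReal.ofReal T := by
    have hnn : ∀ p, 0 ≤ codeBound μ₀ μ Q s p := fun ⟨x, y⟩ => (codeBound_spec hs hs1 hac x y).1
    rw [lintegral_outcomeLaw_mul μ Q hl, ← hTs.tsum_eq,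
      ENNReal.ofReal_tsum_of_nonneg hnn hTs.summable]
    exact ENNReal.tsum_le_tsum fun ⟨x, y⟩ => (codeBound_spec hs hs1 hac x y).2
  have hgibbs : ∀ᵐ z ∂clocks 𝒴, ENNReal.ofReal (ent2 (outcomeLaw μ Q z)) +
      ENNReal.ofReal (Real.log 2)⁻¹ ≤ ∑' y, outcomeLaw μ Q z y * l y z +
        ENNReal.ofReal (Real.log 2)⁻¹ * ∑' y, r y z := by
    filter_upwards [ae_clocks_pos] with z hz
    refine ent2_add_le _ _ _ fun y => ?_
    by_cases hy : (μ₀.bind Q) y = 0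
    · exact Or.inl (if_pos hy)
    · exact Or.inr ⟨_, codeWeight_pos hs (ENNReal.toReal_pos hy (PMF.apply_ne_top _ _)) (hz y),
        if_neg hy, if_neg hy⟩
  have hmeas : Measurable fun z => ∑' y, outcomeLaw μ Q z y * l y z :=
    .tsum fun y => (measurable_outcomeLaw μ Q y).mul (hl y)
  have h := lintegral_mono_ae hgibbs
  rw [lintegral_add_right _ measurable_const, lintegral_add_left hmeas,
    lintegral_const_mul' _ _ ENNReal.ofReal_ne_top, lintegral_const, measure_univ, mul_one] at h
  have h2 := h.trans (add_le_add hcode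
    (mul_le_mul_right (lintegral_codeWeight_le (μ₀.bind Q) hs) _))
  rw [mul_one] at h2
  exact (ENNReal.le_of_add_le_add_right ENNReal.ofReal_ne_top h2).trans
    (ENNReal.ofReal_le_ofReal hT)

lemma integral_ent2_outcomeLaw_le {μ₀ μ : PMF 𝒳} {Q : 𝒳 → PMF 𝒴} {Γ J : ℝ}
    (hΓ : 0 ≤ Γ) (hkl : klDivE μ μ₀ ≤ ENNReal.ofReal Γ)
    (hI : Summable (miSummand μ Q)) (hJ : mutInfo μ Q + Γ ≤ J) :
    ∫ z, ent2 (outcomeLaw μ Q z) ∂clocks 𝒴 ≤ J + Real.logb 2 (J + 1) + 4 := by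
  have hJ0 : 0 ≤ J := (add_nonneg (mutInfo_nonneg hI) hΓ).trans hJ
  have hlog : 0 ≤ Real.logb 2 (J + 1) := Real.logb_nonneg one_lt_two (by linarith)
  have hs : 0 < (J + 1)⁻¹ := by positivity
  have hs1 : (J + 1)⁻¹ ≤ 1 := inv_le_one_of_one_le₀ (by linarith)
  have hc1 : 1 ≤ (Real.log 2)⁻¹ :=
    (one_le_inv₀ (Real.log_pos one_lt_two)).2 (by linarith [Real.log_two_lt_d9])
  have hc2 : (Real.log 2)⁻¹ ≤ 2 :=
    (inv_le_comm₀ (Real.log_pos one_lt_two) two_pos).2 (by linarith [Real.log_two_gt_d9])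
  by_cases hint : Integrable (fun z => ent2 (outcomeLaw μ Q z)) (clocks 𝒴)
  · rw [← ENNReal.ofReal_le_ofReal_iff (by positivity),
      ofReal_integral_eq_lintegral_ofReal hint (ae_of_all _ fun z => ent2_nonneg _)]
    refine (lintegral_ent2_outcomeLaw_le hs hs1 hΓ hkl hI).trans (ENNReal.ofReal_le_ofReal ?_)
    rw [Real.logb_inv, neg_neg]
    have h1 : (1 + (J + 1)⁻¹) * (mutInfo μ Q + Γ + (Real.log 2)⁻¹) ≤
        (1 + (J + 1)⁻¹) * (J + (Real.log 2)⁻¹) :=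
      mul_le_mul_of_nonneg_left (by linarith) (by positivity)
    have h2 : (J + 1)⁻¹ * (J + (Real.log 2)⁻¹) ≤ (Real.log 2)⁻¹ := by
      rw [inv_mul_le_iff₀ (by positivity)]
      nlinarith
    linarith
  · rw [integral_undef hint]
    positivity

variable [MeasurableSpace 𝒳] [DiscreteMeasurableSpace 𝒳]

lemma map_raceOutcome (μ : PMF 𝒳) (Q : 𝒳 → PMF 𝒴) :
    ((μ.toMeasure.prod (clocks 𝒴)).map fun ω => (ω.1, raceOutcome (Q ω.1) ω.2)) =
      (jointPMF μ Q).toMeasure := by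
  refine Measure.ext_of_singleton fun ⟨x, y⟩ => ?_
  rw [Measure.map_apply (measurable_fst.prodMk (measurable_uncurry_raceOutcome Q))
    (measurableSet_singleton _), PMF.toMeasure_apply_singleton _ _ (measurableSet_singleton _),
    jointPMF_apply]
  have : (fun ω : 𝒳 × (𝒴 → ℝ) => (ω.1, raceOutcome (Q ω.1) ω.2)) ⁻¹' {(x, y)} =
      {x} ×ˢ {z | raceOutcome (Q x) z = y} := by
    ext ⟨x', z⟩
    simp only [mem_preimage, mem_singleton_iff, Prod.mk.injEq, mem_prod, mem_ofPred_eq]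
    constructor <;> (rintro ⟨rfl, h⟩; exact ⟨rfl, h⟩)
  rw [this, Measure.prod_prod, PMF.toMeasure_apply_singleton _ _ (measurableSet_singleton _),
    clocks_raceOutcome]

lemma isCondDistrib_outcomeLaw (μ : PMF 𝒳) (Q : 𝒳 → PMF 𝒴) :
    IsCondDistrib (μ.toMeasure.prod (clocks 𝒴)) (fun ω => raceOutcome (Q ω.1) ω.2) Prod.snd
      (outcomeLaw μ Q) := by
  refine ⟨measurable_outcomeLaw μ Q, fun y A hA => ?_⟩
  have hsnd : (μ.toMeasure.prod (clocks 𝒴)).map Prod.snd = clocks 𝒴 := measurePreserving_snd.map_eq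
  have hms : MeasurableSet {ω : 𝒳 × (𝒴 → ℝ) | raceOutcome (Q ω.1) ω.2 = y ∧ ω.2 ∈ A} :=
    (measurable_uncurry_raceOutcome Q (measurableSet_singleton y)).inter (measurable_snd hA)
  rw [hsnd, Measure.prod_apply_symm hms, ← lintegral_indicator hA]
  refine lintegral_congr fun z => ?_
  by_cases hz : z ∈ A
  · have : (fun x : 𝒳 => (x, z)) ⁻¹' {ω | raceOutcome (Q ω.1) ω.2 = y ∧ ω.2 ∈ A} =
        (fun x => raceOutcome (Q x) z) ⁻¹' {y} := by
      ext x; simp [hz]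
    rw [this, indicator_of_mem hz, outcomeLaw,
      ← PMF.toMeasure_apply_singleton _ y (measurableSet_singleton y),
      PMF.toMeasure_map_apply _ _ _ (Measurable.of_discrete) (measurableSet_singleton y)]
  · simp [hz]

end Representation

/-- **KL-Robust Strong Functional Representation Lemma.**
Given a nominal pmf `μ₀` on `𝒳`, `Γ ≥ 0`, the KL-sphere `𝒮(Γ) = {μ : D(μ‖μ₀) ≤ Γ}`,
and a Markov kernel `Q` with `I(μ, Q) < ∞` for every `μ ∈ 𝒮(Γ)`, and
`Ī = sup_{μ ∈ 𝒮(Γ)} I(μ, Q)`, there exist a probability space carrying `Z` (here: a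
probability measure `PZ` on some measurable space `𝒵`, `Z` being the second coordinate of
the product space) and a measurable `g : 𝒳 × 𝒵 → 𝒴` such that for every `μ ∈ 𝒮(Γ)`,
if `X ∼ μ` is independent of `Z` and `Y = g(X, Z)`, then `(X, Y)` has joint pmf
`μ(x)Q(y|x)` and `H(Y | Z) ≤ Ī + Γ + log₂(Ī + Γ + 1) + 4`. -/
theorem robust_sfrl_klsphere
    {𝒳 𝒴 : Type} [Countable 𝒳] [Countable 𝒴]
    [MeasurableSpace 𝒳] [DiscreteMeasurableSpace 𝒳]
    [MeasurableSpace 𝒴] [DiscreteMeasurableSpace 𝒴]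
    (μ₀ : PMF 𝒳) (Γ : ℝ) (hΓ : 0 ≤ Γ) (Q : 𝒳 → PMF 𝒴)
    (hI : ∀ μ : PMF 𝒳, klDivE μ μ₀ ≤ ENNReal.ofReal Γ → Summable (miSummand μ Q))
    (Ibar : ℝ)
    (hIbar : IsLUB {r : ℝ | ∃ μ : PMF 𝒳, klDivE μ μ₀ ≤ ENNReal.ofReal Γ ∧
        r = mutInfo μ Q} Ibar) :
    ∃ (𝒵 : Type) (_ : MeasurableSpace 𝒵) (PZ : Measure 𝒵) (g : 𝒳 × 𝒵 → 𝒴),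
      IsProbabilityMeasure PZ ∧ Measurable g ∧
      ∀ μ : PMF 𝒳, klDivE μ μ₀ ≤ ENNReal.ofReal Γ →
        ((μ.toMeasure.prod PZ).map fun ω => (ω.1, g ω)) = (jointPMF μ Q).toMeasure ∧
        ∃ κ : 𝒵 → PMF 𝒴,
          IsCondDistrib (μ.toMeasure.prod PZ) (fun ω => g ω) Prod.snd κ ∧
          ∫ z, ent2 (κ z) ∂PZ ≤ Ibar + Γ + Real.logb 2 (Ibar + Γ + 1) + 4 := by
  obtain ⟨x₀, -⟩ := μ₀.support_nonempty
  have : Nonempty 𝒴 := ⟨(Q x₀).support_nonempty.some⟩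
  refine ⟨𝒴 → ℝ, inferInstance, clocks 𝒴, fun ω => raceOutcome (Q ω.1) ω.2, inferInstance,
    measurable_uncurry_raceOutcome Q, fun μ hμ => ⟨map_raceOutcome μ Q, outcomeLaw μ Q,
      isCondDistrib_outcomeLaw μ Q, integral_ent2_outcomeLaw_le hΓ hμ (hI μ hμ) ?_⟩⟩
  exact add_le_add (hIbar.1 ⟨μ, hμ, rfl⟩) le_rfl
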